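/- arXiv:2401.12065 — 2 statements merged into one kernel-verified Lean document; each statement's English description precedes it below -/
import Mathlib

section
/- Let Γ be an ATB-friendly edge-signed graph embedded in the annulus A. Then ATB(Γ) = 0 if and only if Γ = Γ_A(g) for some element g of Thompson's group T. -/
/-- A planar rooted binary tree. -/
inductive PlanarBinTree : Type
  | leaf : PlanarBinTree
  | node : PlanarBinTree → PlanarBinTree → PlanarBinTree
  deriving DecidableEq

namespace PlanarBinTree

/-- The number of leaves of a planar rooted binary tree. -/
def leaves : PlanarBinTree → ℕ
  | leaf => 1
  | node l r => l.leaves + r.leaves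

end PlanarBinTree

/-- A triple `(R,S;k)` of planar rooted binary trees together with an integer `k`,
representing an element of Thompson's group `T`:  `g` sends the first interval of the
standard dyadic partition encoded by `R` to the `k`-th interval of the partition encoded
by `S`. -/
structure TTriple where
  R : PlanarBinTree
  S : PlanarBinTree
  k : ℕ

/-- The triple `(R,S;k)` genuinely represents an element of Thompson's group `T`:
`R` and `S` have the same number `n` of leaves and `1 ≤ k ≤ n`. -/
def TTriple.Valid (g : TTriple) : Prop :=
  g.R.leaves = g.S.leaves ∧ 1 ≤ g.k ∧ g.k ≤ g.R.leaves

/-- Combinatorial model of an ATB-friendly edge-signed graph embedded in the annulus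
`𝔸 = D² ∖ {0}`: all vertices lie on the `x`-axis, no loops, and each edge lies entirely in
the upper or lower half-plane.  The `N` vertices are recorded by their left-to-right
position `0, …, N-1` on the axis; `numLeft` of them (positions `0, …, numLeft - 1`) lie to
the left of the origin (the puncture), the rest to its right.  An edge is a quadruple
`(a, b, up, sign)`: `a` is the position of its left endpoint, `b` the position of its
right (terminal) endpoint, `up = true` iff its interior lies in the upper half-plane, and
`sign = true` iff the edge is signed `+`.  An edge wraps (stretches over the origin) iff
`a < numLeft ≤ b`. -/
structure SignedAnnularGraph where
  N : ℕ
  numLeft : ℕ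
  edges : Multiset (ℕ × ℕ × Bool × Bool)

namespace SignedAnnularGraph

variable (Γ : SignedAnnularGraph)

/-- Well-formedness of the combinatorial data as an ATB-friendly edge-signed graph
embedded in the annulus: there is at least one vertex, the vertex `v₁` immediately to the
right of the origin exists, every edge goes from a strictly smaller position to a strictly
larger one (in particular there are no loops), its endpoints are genuine vertices, and
edges lying in the same half-plane are nested or disjoint (embeddedness). -/
def Wf : Prop :=
  0 < Γ.N ∧ Γ.numLeft < Γ.N ∧
    (∀ e ∈ Γ.edges, e.1 < e.2.1 ∧ e.2.1 < Γ.N) ∧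
    (∀ e ∈ Γ.edges, ∀ f ∈ Γ.edges, e.2.2.1 = f.2.2.1 →
      ¬(e.1 < f.1 ∧ f.1 < e.2.1 ∧ e.2.1 < f.2.1))

/-- The label `l(v)` of the vertex at position `p`: the vertex `v₁` immediately to the
right of the origin gets label `1`, labels increase rightwards to the rightmost vertex,
then continue from the leftmost vertex `v_L` rightwards to the vertex immediately to the
left of the origin, which gets label `N`. -/
def label (p : ℕ) : ℕ :=
  if Γ.numLeft ≤ p then p - Γ.numLeft + 1 else p + (Γ.N - Γ.numLeft) + 1

/-- `|e^in_v ∩ e^down|`: the number of lower edges whose terminal vertex is `v`. -/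
def inDown (v : ℕ) : ℕ :=
  (Γ.edges.filter fun e => e.2.1 = v ∧ e.2.2.1 = false).card

/-- `|e^<_v ∩ e^up|`: the number of upper edges connecting `v` to a vertex of strictly
smaller label. -/
def ltUp (v : ℕ) : ℕ :=
  (Γ.edges.filter fun e => e.2.2.1 = true ∧
    ((e.1 = v ∧ Γ.label e.2.1 < Γ.label v) ∨ (e.2.1 = v ∧ Γ.label e.1 < Γ.label v))).card

/-- `|e^up_-|`: the number of negative upper edges. -/
def upNeg : ℕ := (Γ.edges.filter fun e => e.2.2.1 = true ∧ e.2.2.2 = false).card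

/-- `|e^down_+|`: the number of positive lower edges. -/
def downPos : ℕ := (Γ.edges.filter fun e => e.2.2.1 = false ∧ e.2.2.2 = true).card

/-- `Σ_{v ≠ v_L} |1 - |e^in_v ∩ e^down||` (the leftmost vertex `v_L` is at position `0`). -/
def sumDown : ℕ :=
  ∑ p ∈ Finset.range Γ.N, if p = 0 then 0 else (1 - (Γ.inDown p : ℤ)).natAbs

/-- `Σ_{v ≠ v₁} |1 - |e^<_v ∩ e^up||` (the vertex `v₁` immediately to the right of the
origin is at position `numLeft`). -/
def sumUp : ℕ :=
  ∑ p ∈ Finset.range Γ.N, if p = Γ.numLeft then 0 else (1 - (Γ.ltUp p : ℤ)).natAbs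

/-- Annular Thompson Badness:
`ATB(Γ) = Σ_{v ≠ v_L} |1 - |e^in_v ∩ e^down|| + Σ_{v ≠ v₁} |1 - |e^<_v ∩ e^up||
  + |e^up_-| + |e^down_+|`. -/
def ATB : ℕ := Γ.sumDown + Γ.sumUp + Γ.upNeg + Γ.downPos

end SignedAnnularGraph

/-- The edges of the graph `Γ(R)` associated to a tree `R` whose leaves are indexed
starting at `o`: one vertex immediately to the left of each leaf, and for each edge of `R`
sloping up and to the right (i.e. each edge from a node to its left child, whose subtree
spans leaves `a, …, b`) one transversal edge of `Γ(R)` joining vertex `a` to vertex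
`b + 1`. -/
def treeGraphEdges : PlanarBinTree → ℕ → Multiset (ℕ × ℕ)
  | .leaf, _ => 0
  | .node l r, o =>
      (o, o + l.leaves) ::ₘ (treeGraphEdges l o + treeGraphEdges r (o + l.leaves))

/-- The position on the axis of the vertex with (1-based) label `lab`, in an annular graph
with `N` vertices of which `numLeft` lie to the left of the origin. -/
def posOfLabel (N numLeft lab : ℕ) : ℕ :=
  if lab ≤ N - numLeft then lab + numLeft - 1 else lab - (N - numLeft) - 1

/-- The edge-signed graph `Γ_𝔸(g)` embedded in the annulus associated to a triple
`g = (R,S;k)`: the lower part is `Γ(S)` (reflected below the axis, signed `-`), the upper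
part is `Γ(R)` (signed `+`), where vertex `i` of `Γ(R)` is identified with the vertex of
label `i + 1` (so the first vertex of `Γ(R)` is the `k`-th vertex of `Γ(S)`), upper edges
attaching to the left wrapping counterclockwise around the annulus (i.e. stretching over
the origin). -/
def gammaA (g : TTriple) : SignedAnnularGraph :=
  let n := g.R.leaves
  let nl := (n - g.k + 1) % n
  { N := n
    numLeft := nl
    edges :=
      (treeGraphEdges g.S 0).map (fun e => (e.1, e.2, false, false)) +
      (treeGraphEdges g.R 0).map (fun e =>
        (min (posOfLabel n nl (e.1 + 1)) (posOfLabel n nl (e.2 + 1)),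
         max (posOfLabel n nl (e.1 + 1)) (posOfLabel n nl (e.2 + 1)), true, true)) }

/-- Reindexing of vertex positions after inserting a new vertex at position `q`. -/
def shiftIdx (q v : ℕ) : ℕ := if v < q then v else v + 1

/-- Reindexing of an edge after inserting a new vertex at position `q`. -/
def shiftEdge (q : ℕ) (e : ℕ × ℕ × Bool × Bool) : ℕ × ℕ × Bool × Bool :=
  (shiftIdx q e.1, shiftIdx q e.2.1, e.2.2)

/-- Jones' 2-move of Type I (forward direction): adding a `1`-valent vertex together with
its edge.  The new vertex is inserted at position `q`, on the left of the origin
(`nl' = numLeft + 1`) or on its right (`nl' = numLeft`). -/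
def MoveTypeI (Γ Γ' : SignedAnnularGraph) : Prop :=
  ∃ (q nl' : ℕ) (e : ℕ × ℕ × Bool × Bool),
    q ≤ Γ.N ∧ (e.1 = q ∨ e.2.1 = q) ∧ e.1 < e.2.1 ∧ e.2.1 ≤ Γ.N ∧
    ((nl' = Γ.numLeft + 1 ∧ q ≤ Γ.numLeft) ∨ (nl' = Γ.numLeft ∧ Γ.numLeft ≤ q)) ∧
    Γ' = ⟨Γ.N + 1, nl', e ::ₘ Γ.edges.map (shiftEdge q)⟩

/-- Jones' 2-move of Type IIa (forward direction): replacing an edge by a length-two path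
through a new `2`-valent vertex, the two new edges having opposite signs. -/
def MoveTypeIIa (Γ Γ' : SignedAnnularGraph) : Prop :=
  ∃ (a b : ℕ) (u s : Bool) (q : ℕ) (t : Bool) (nl' : ℕ),
    (a, b, u, s) ∈ Γ.edges ∧ a < q ∧ q ≤ b ∧
    ((nl' = Γ.numLeft + 1 ∧ q ≤ Γ.numLeft) ∨ (nl' = Γ.numLeft ∧ Γ.numLeft ≤ q)) ∧
    Γ' = ⟨Γ.N + 1, nl',
      (a, q, u, t) ::ₘ (q, b + 1, u, !t) ::ₘ (Γ.edges.erase (a, b, u, s)).map (shiftEdge q)⟩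

/-- Jones' 2-move of Type IIb (forward direction): adding a pair of parallel edges of
opposite signs between two vertices. -/
def MoveTypeIIb (Γ Γ' : SignedAnnularGraph) : Prop :=
  ∃ (a b : ℕ) (u : Bool), a < b ∧ b < Γ.N ∧
    Γ' = ⟨Γ.N, Γ.numLeft, (a, b, u, true) ::ₘ (a, b, u, false) ::ₘ Γ.edges⟩

/-- A single 2-move (any of Jones' moves of Type I, IIa, IIb, in either direction). -/
def Move (Γ Γ' : SignedAnnularGraph) : Prop :=
  MoveTypeI Γ Γ' ∨ MoveTypeI Γ' Γ ∨ MoveTypeIIa Γ Γ' ∨ MoveTypeIIa Γ' Γ ∨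
    MoveTypeIIb Γ Γ' ∨ MoveTypeIIb Γ' Γ

/-- Two edge-signed graphs embedded in the annulus are 2-equivalent if they are related by
a finite sequence of Jones' 2-moves. -/
def TwoEquiv : SignedAnnularGraph → SignedAnnularGraph → Prop :=
  Relation.ReflTransGen Move

theorem aux_tree_mem (t : PlanarBinTree) : 0 < t.leaves ∧ ∀ o, ∀ e ∈ treeGraphEdges t o,
    o ≤ e.1 ∧ e.1 < e.2 ∧ e.2 < o + t.leaves := by
  induction t with
  | leaf => simp [treeGraphEdges, PlanarBinTree.leaves]
  | node l r hl hr =>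
    obtain ⟨hl0, hl⟩ := hl
    obtain ⟨hr0, hr⟩ := hr
    refine ⟨by simp only [PlanarBinTree.leaves]; omega, ?_⟩
    intro o e he
    simp only [treeGraphEdges, Multiset.mem_cons, Multiset.mem_add] at he
    simp only [PlanarBinTree.leaves]
    rcases he with rfl | he | he
    · simp only; omega
    · have := hl _ _ he; omega
    · have := hr _ _ he; omega

theorem aux_tree_card (t : PlanarBinTree) : ∀ o j, o < j → j < o + t.leaves →
    ((treeGraphEdges t o).filter (fun e => e.2 = j)).card = 1 := by
  induction t with
  | leaf => intro o j h1 h2; simp only [PlanarBinTree.leaves] at h2; omega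
  | node l r hl hr =>
    intro o j h1 h2
    simp only [PlanarBinTree.leaves] at h2
    have hlm := aux_tree_mem l
    have hrm := aux_tree_mem r
    have zl : ∀ j, o + l.leaves ≤ j →
        (treeGraphEdges l o).filter (fun e => e.2 = j) = 0 := by
      intro j hj
      rw [Multiset.filter_eq_nil]
      intro e he h
      have := hlm.2 _ _ he
      omega
    have zr : ∀ j, j ≤ o + l.leaves →
        (treeGraphEdges r (o + l.leaves)).filter (fun e => e.2 = j) = 0 := by
      intro j hj
      rw [Multiset.filter_eq_nil]
      intro e he h
      have := hrm.2 _ _ he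
      omega
    simp only [treeGraphEdges]
    rcases lt_trichotomy j (o + l.leaves) with h | h | h
    · rw [Multiset.filter_cons_of_neg _ (by simp only; omega), Multiset.filter_add,
        zr j h.le, add_zero, hl o j h1 h]
    · rw [Multiset.filter_cons_of_pos _ (by simp only; omega), Multiset.filter_add,
        zr j h.le, zl j h.ge]
      simp
    · rw [Multiset.filter_cons_of_neg _ (by simp only; omega), Multiset.filter_add,
        zl j h.le, zero_add, hr _ j h (by omega)]

theorem aux_exists_tree (n : ℕ) : 0 < n → ∀ (o : ℕ) (E : Multiset (ℕ × ℕ)),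
    (∀ e ∈ E, o ≤ e.1 ∧ e.1 < e.2 ∧ e.2 < o + n) →
    (∀ j, o < j → j < o + n → (E.filter (fun e => e.2 = j)).card = 1) →
    (∀ e ∈ E, ∀ f ∈ E, ¬ (e.1 < f.1 ∧ f.1 < e.2 ∧ e.2 < f.2)) →
    ∃ t : PlanarBinTree, t.leaves = n ∧ treeGraphEdges t o = E := by
  induction n using Nat.strong_induction_on with
  | _ n ih =>
  intro hn o E h1 h2 h3
  by_cases hn1 : n = 1
  · refine ⟨.leaf, by simp [PlanarBinTree.leaves, hn1], ?_⟩
    symm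
    simp only [treeGraphEdges]
    rw [Multiset.eq_zero_iff_forall_notMem]
    intro e he
    have := h1 e he
    omega
  have key : ∀ j, o < j → j < o + n → ∃ x, E.filter (fun e => e.2 = j) = {x} :=
    fun j a b => Multiset.card_eq_one.1 (h2 j a b)
  have hex : ∃ j, (o, j) ∈ E := by
    obtain ⟨x, hx⟩ := key (o + 1) (by omega) (by omega)
    have hm : x ∈ E.filter (fun e => e.2 = o + 1) := by rw [hx]; simp
    rw [Multiset.mem_filter] at hm
    have := h1 x hm.1
    refine ⟨o + 1, ?_⟩
    have : x = (o, o + 1) := by ext <;> simp <;> omega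
    rw [← this]; exact hm.1
  have hmax : ∃ j, (o, j) ∈ E ∧ ∀ i, (o, i) ∈ E → i ≤ j := by
    classical
    obtain ⟨j0, hj0⟩ := hex
    refine ⟨Nat.findGreatest (fun j => (o, j) ∈ E) (o + n), ?_, ?_⟩
    · exact Nat.findGreatest_spec (P := fun j => (o, j) ∈ E) (h1 _ hj0).2.2.le hj0
    · intro i hi
      exact Nat.le_findGreatest (h1 _ hi).2.2.le hi
  obtain ⟨j, hj, hjm⟩ := hmax
  have hjb := h1 _ hj
  simp only at hjb
  obtain ⟨l, hl, hl'⟩ := ih (j - o) (by omega) (by omega) o (E.filter (fun e => e.2 < j))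
    (by
      intro e he
      rw [Multiset.mem_filter] at he
      have := h1 e he.1
      omega)
    (by
      intro i hi hi'
      rw [Multiset.filter_filter, ← h2 i hi (by omega)]
      congr 1
      apply Multiset.filter_congr
      intro e _
      omega)
    (by
      intro e he f hf
      exact h3 e (Multiset.mem_of_mem_filter he) f (Multiset.mem_of_mem_filter hf))
  obtain ⟨r, hr, hr'⟩ := ih (o + n - j) (by omega) (by omega) j (E.filter (fun e => j < e.2))
    (by
      intro e he
      rw [Multiset.mem_filter] at he
      have h := h1 e he.1
      have h4 := h3 _ hj e he.1
      simp only at h4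
      have : e.1 ≠ o := by
        intro h5
        have := hjm e.2 (by rw [← h5]; exact he.1)
        omega
      omega)
    (by
      intro i hi hi'
      rw [Multiset.filter_filter, ← h2 i (by omega) (by omega)]
      congr 1
      apply Multiset.filter_congr
      intro e _
      omega)
    (by
      intro e he f hf
      exact h3 e (Multiset.mem_of_mem_filter he) f (Multiset.mem_of_mem_filter hf))
  refine ⟨.node l r, by simp only [PlanarBinTree.leaves]; omega, ?_⟩
  have hoj : o + l.leaves = j := by omega
  simp only [treeGraphEdges]
  rw [hoj, hl', hr']
  obtain ⟨x, hx⟩ := key j hjb.2.1 hjb.2.2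
  have hm : (o, j) ∈ E.filter (fun e => e.2 = j) := by
    rw [Multiset.mem_filter]; exact ⟨hj, rfl⟩
  rw [hx, Multiset.mem_singleton] at hm
  subst hm
  have e1 := Multiset.filter_add_not (fun e : ℕ × ℕ => e.2 = j) E
  have e2 := Multiset.filter_add_not (fun e : ℕ × ℕ => e.2 < j)
    (E.filter (fun e => ¬ e.2 = j))
  rw [Multiset.filter_filter, Multiset.filter_filter] at e2
  conv_rhs => rw [← e1, hx, ← e2]
  rw [← Multiset.singleton_add]
  congr 2
  · apply Multiset.filter_congr
    intro e _
    omega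
  · apply Multiset.filter_congr
    intro e _
    omega

theorem aux_pos_label (Γ : SignedAnnularGraph) (h : Γ.numLeft < Γ.N) (p : ℕ) (hp : p < Γ.N) :
    posOfLabel Γ.N Γ.numLeft (Γ.label p) = p := by
  unfold posOfLabel SignedAnnularGraph.label
  split_ifs <;> omega

theorem aux_label_pos (Γ : SignedAnnularGraph) (h : Γ.numLeft < Γ.N) (i : ℕ) (hp : i < Γ.N) :
    Γ.label (posOfLabel Γ.N Γ.numLeft (i + 1)) = i + 1 ∧
      posOfLabel Γ.N Γ.numLeft (i + 1) < Γ.N := by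
  unfold posOfLabel SignedAnnularGraph.label
  split_ifs <;> omega

theorem aux_label_cases (Γ : SignedAnnularGraph) (h : Γ.numLeft < Γ.N) (p : ℕ) (hp : p < Γ.N) :
    (Γ.numLeft ≤ p ∧ Γ.label p + Γ.numLeft = p + 1) ∨
      (p < Γ.numLeft ∧ Γ.label p + Γ.numLeft = p + Γ.N + 1) := by
  unfold SignedAnnularGraph.label
  split_ifs <;> omega

theorem aux_ATB (Γ : SignedAnnularGraph) : Γ.ATB = 0 ↔
    (∀ p < Γ.N, p ≠ 0 → Γ.inDown p = 1) ∧ (∀ p < Γ.N, p ≠ Γ.numLeft → Γ.ltUp p = 1) ∧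
    (∀ e ∈ Γ.edges, e.2.2.1 = e.2.2.2) := by
  have hz : ∀ c : ℕ, (1 - (c : ℤ)).natAbs = 0 ↔ c = 1 := by intro c; omega
  unfold SignedAnnularGraph.ATB SignedAnnularGraph.sumDown SignedAnnularGraph.sumUp
    SignedAnnularGraph.upNeg SignedAnnularGraph.downPos
  simp only [Nat.add_eq_zero_iff, Finset.sum_eq_zero_iff, Finset.mem_range, ite_eq_left_iff, hz,
    Multiset.card_eq_zero, Multiset.filter_eq_nil]
  constructor
  · rintro ⟨⟨⟨a, b⟩, c⟩, d⟩
    refine ⟨a, b, ?_⟩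
    intro e he
    have := c e he
    have := d e he
    cases h1 : e.2.2.1 <;> cases h2 : e.2.2.2 <;> simp_all
  · rintro ⟨a, b, c⟩
    refine ⟨⟨⟨a, b⟩, ?_⟩, ?_⟩ <;>
    · intro e he
      have := c e he
      cases h1 : e.2.2.1 <;> cases h2 : e.2.2.2 <;> simp_all

theorem aux_forward (Γ : SignedAnnularGraph) (hΓ : Γ.Wf) (h : Γ.ATB = 0) :
    ∃ g : TTriple, g.Valid ∧ Γ = gammaA g := by
  obtain ⟨hN, hnl, hE, hC⟩ := hΓ
  obtain ⟨hD, hU, hS⟩ := (aux_ATB Γ).1 h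
  obtain ⟨S, hSl, hSe⟩ := aux_exists_tree Γ.N hN 0
    ((Γ.edges.filter (fun e => ¬ e.2.2.1 = true)).map (fun e => (e.1, e.2.1)))
    (by
      intro e he
      obtain ⟨f, hf, rfl⟩ := Multiset.mem_map.1 he
      have := hE f (Multiset.mem_of_mem_filter hf)
      simp only
      omega)
    (by
      intro j hj hj'
      rw [Multiset.filter_map, Multiset.card_map, Multiset.filter_filter,
        ← hD j (by omega) (by omega)]
      unfold SignedAnnularGraph.inDown
      congr 1
      apply Multiset.filter_congr
      intro e _
      simp)
    (by
      intro e' he' f' hf'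
      obtain ⟨e, he, rfl⟩ := Multiset.mem_map.1 he'
      obtain ⟨f, hf, rfl⟩ := Multiset.mem_map.1 hf'
      rw [Multiset.mem_filter] at he hf
      have h4 := he.2
      have h5 := hf.2
      rw [Bool.not_eq_true] at h4 h5
      exact hC e he.1 f hf.1 (by rw [h4, h5]))
  obtain ⟨R, hRl, hRe⟩ := aux_exists_tree Γ.N hN 0
    ((Γ.edges.filter (fun e => e.2.2.1 = true)).map (fun e =>
      (min (Γ.label e.1) (Γ.label e.2.1) - 1, max (Γ.label e.1) (Γ.label e.2.1) - 1)))
    (by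
      intro e he
      obtain ⟨f, hf, rfl⟩ := Multiset.mem_map.1 he
      have := hE f (Multiset.mem_of_mem_filter hf)
      have := aux_label_cases Γ hnl f.1 (by omega)
      have := aux_label_cases Γ hnl f.2.1 (by omega)
      simp only
      omega)
    (by
      intro j hj hj'
      have hp := aux_label_pos Γ hnl j (by omega)
      generalize hq : posOfLabel Γ.N Γ.numLeft (j + 1) = q at hp
      have hqc := aux_label_cases Γ hnl q hp.2
      rw [Multiset.filter_map, Multiset.card_map, Multiset.filter_filter]
      have hUq := hU q hp.2 (by omega)
      unfold SignedAnnularGraph.ltUp at hUq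
      refine Eq.trans (congrArg _ ?_) hUq
      apply Multiset.filter_congr
      intro e he
      have := hE e he
      have := aux_label_cases Γ hnl e.1 (by omega)
      have := aux_label_cases Γ hnl e.2.1 (by omega)
      simp only [Function.comp]
      by_cases hu : e.2.2.1 = true
      · simp only [hu, and_true, true_and]
        constructor
        · intro h
          by_cases hlt : Γ.label e.1 < Γ.label e.2.1
          · right
            have : e.2.1 = q := by omega
            rw [← this]; omega
          · left
            have : e.1 = q := by omega
            rw [← this]; omega
        · rintro (⟨h, h'⟩ | ⟨h, h'⟩) <;> rw [h] at * <;> omega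
      · simp [hu])
    (by
      intro e' he' f' hf'
      obtain ⟨e, he, rfl⟩ := Multiset.mem_map.1 he'
      obtain ⟨f, hf, rfl⟩ := Multiset.mem_map.1 hf'
      rw [Multiset.mem_filter] at he hf
      have c1 := hC e he.1 f hf.1 (by rw [he.2, hf.2])
      have c2 := hC f hf.1 e he.1 (by rw [he.2, hf.2])
      have := hE e he.1
      have := hE f hf.1
      have := aux_label_cases Γ hnl e.1 (by omega)
      have := aux_label_cases Γ hnl e.2.1 (by omega)
      have := aux_label_cases Γ hnl f.1 (by omega)
      have := aux_label_cases Γ hnl f.2.1 (by omega)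
      simp only
      omega)
  have hk : (Γ.N - (if Γ.numLeft = 0 then 1 else Γ.N - Γ.numLeft + 1) + 1) % Γ.N = Γ.numLeft := by
    split_ifs with h0
    · rw [h0, show Γ.N - 1 + 1 = Γ.N by omega, Nat.mod_self]
    · rw [show Γ.N - (Γ.N - Γ.numLeft + 1) + 1 = Γ.numLeft by omega, Nat.mod_eq_of_lt hnl]
  refine ⟨⟨R, S, if Γ.numLeft = 0 then 1 else Γ.N - Γ.numLeft + 1⟩, ⟨?_, ?_, ?_⟩, ?_⟩
  · simp only; omega
  · simp only; split_ifs <;> omega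
  · simp only; split_ifs <;> omega
  · unfold gammaA
    simp only [hRl, hk, hSe, hRe, Multiset.map_map, Function.comp_def]
    have e1 := Multiset.filter_add_not (fun e : ℕ × ℕ × Bool × Bool => e.2.2.1 = true) Γ.edges
    have e2 : (Γ.edges.filter (fun e => ¬ e.2.2.1 = true)).map
        (fun e => (e.1, e.2.1, false, false)) = Γ.edges.filter (fun e => ¬ e.2.2.1 = true) := by
      conv_rhs => rw [← Multiset.map_id (Γ.edges.filter (fun e => ¬ e.2.2.1 = true))]
      apply Multiset.map_congr rfl
      intro e he
      rw [Multiset.mem_filter] at he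
      have h1 := hS e he.1
      have h2 := he.2
      rw [Bool.not_eq_true] at h2
      rw [h2] at h1
      obtain ⟨a, b, c, d⟩ := e
      simp only at h1 h2
      subst h1 h2
      rfl
    have e3 : (Γ.edges.filter (fun e => e.2.2.1 = true)).map
        (fun e => (min (posOfLabel Γ.N Γ.numLeft (min (Γ.label e.1) (Γ.label e.2.1) - 1 + 1))
            (posOfLabel Γ.N Γ.numLeft (max (Γ.label e.1) (Γ.label e.2.1) - 1 + 1)),
          max (posOfLabel Γ.N Γ.numLeft (min (Γ.label e.1) (Γ.label e.2.1) - 1 + 1))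
            (posOfLabel Γ.N Γ.numLeft (max (Γ.label e.1) (Γ.label e.2.1) - 1 + 1)), true, true))
        = Γ.edges.filter (fun e => e.2.2.1 = true) := by
      conv_rhs => rw [← Multiset.map_id (Γ.edges.filter (fun e => e.2.2.1 = true))]
      apply Multiset.map_congr rfl
      intro e he
      rw [Multiset.mem_filter] at he
      have h1 := hS e he.1
      have h2 := he.2
      have h3 := hE e he.1
      have l1 := aux_label_cases Γ hnl e.1 (by omega)
      have l2 := aux_label_cases Γ hnl e.2.1 (by omega)
      have p1 := aux_pos_label Γ hnl e.1 (by omega)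
      have p2 := aux_pos_label Γ hnl e.2.1 (by omega)
      have hfin : (e.1, e.2.1, true, true) = id e := by
        rw [h2] at h1
        obtain ⟨a, b, c, d⟩ := e
        simp only at h1 h2
        subst h1 h2
        rfl
      rw [Nat.sub_add_cancel (by omega), Nat.sub_add_cancel (by omega)]
      rcases le_total (Γ.label e.1) (Γ.label e.2.1) with hle | hle
      · rw [min_eq_left hle, max_eq_right hle, p1, p2, min_eq_left h3.1.le, max_eq_right h3.1.le]
        exact hfin
      · rw [min_eq_right hle, max_eq_left hle, p1, p2, min_eq_right h3.1.le, max_eq_left h3.1.le]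
        exact hfin
    rw [e2, e3, add_comm, e1]

theorem aux_backward (g : TTriple) (hg : g.Valid) : (gammaA g).ATB = 0 := by
  obtain ⟨hl, hk1, hk2⟩ := hg
  have hN : (gammaA g).N = g.R.leaves := rfl
  have hnl : (gammaA g).numLeft < (gammaA g).N := Nat.mod_lt _ (by omega)
  have hed : (gammaA g).edges =
      (treeGraphEdges g.S 0).map (fun e => (e.1, e.2, false, false)) +
      (treeGraphEdges g.R 0).map (fun e =>
        (min (posOfLabel (gammaA g).N (gammaA g).numLeft (e.1 + 1))
          (posOfLabel (gammaA g).N (gammaA g).numLeft (e.2 + 1)),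
         max (posOfLabel (gammaA g).N (gammaA g).numLeft (e.1 + 1))
          (posOfLabel (gammaA g).N (gammaA g).numLeft (e.2 + 1)), true, true)) := rfl
  generalize gammaA g = Γ at *
  rw [aux_ATB]
  refine ⟨?_, ?_, ?_⟩
  · intro p hp hp0
    unfold SignedAnnularGraph.inDown
    rw [hed, Multiset.filter_add, Multiset.filter_map, Multiset.filter_map, Multiset.card_add,
      Multiset.card_map, Multiset.card_map]
    simp only [Function.comp_def]
    simp only [and_true, Bool.true_eq_false, and_false, Multiset.filter_false, Multiset.card_zero,
      add_zero]
    exact aux_tree_card g.S 0 p (by omega) (by omega)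
  · intro p hp hp0
    have lp := aux_label_cases Γ hnl p hp
    unfold SignedAnnularGraph.ltUp
    rw [hed, Multiset.filter_add, Multiset.filter_map, Multiset.filter_map, Multiset.card_add,
      Multiset.card_map, Multiset.card_map]
    simp only [Function.comp_def]
    simp only [Bool.false_eq_true, false_and, true_and, Multiset.filter_false, Multiset.card_zero,
      zero_add]
    refine Eq.trans (congrArg _ ?_)
      (aux_tree_card g.R 0 (Γ.label p - 1) (by omega) (by omega))
    apply Multiset.filter_congr
    intro e he
    have hm := (aux_tree_mem g.R).2 0 e he
    have l1 := aux_label_pos Γ hnl e.1 (by omega)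
    have l2 := aux_label_pos Γ hnl e.2 (by omega)
    have pp := aux_pos_label Γ hnl p hp
    have hpe : posOfLabel Γ.N Γ.numLeft (e.2 + 1) = p ↔ e.2 = Γ.label p - 1 := by
      constructor
      · intro h; rw [h] at l2; omega
      · intro h; rw [h, Nat.sub_add_cancel (by omega), pp]
    rw [← hpe]
    generalize posOfLabel Γ.N Γ.numLeft (e.2 + 1) = x at *
    generalize posOfLabel Γ.N Γ.numLeft (e.1 + 1) = y at *
    rcases le_total y x with hle | hle
    · rw [min_eq_left hle, max_eq_right hle]
      constructor
      · rintro (⟨h, h'⟩ | ⟨h, h'⟩)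
        · subst h; omega
        · exact h
      · intro h; subst h; right; omega
    · rw [min_eq_right hle, max_eq_left hle]
      constructor
      · rintro (⟨h, h'⟩ | ⟨h, h'⟩)
        · exact h
        · subst h; omega
      · intro h; subst h; left; omega
  · intro e he
    rw [hed, Multiset.mem_add, Multiset.mem_map, Multiset.mem_map] at he
    rcases he with ⟨f, _, rfl⟩ | ⟨f, _, rfl⟩ <;> rfl

/-- **Proposition 3.3.**  Let `Γ` be an ATB-friendly edge-signed graph embedded in the
annulus `𝔸`.  Then `ATB(Γ) = 0` if and only if `Γ = Γ_𝔸(g)` for some element `g` of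
Thompson's group `T`. -/
theorem ATB_eq_zero_iff_gammaA (Γ : SignedAnnularGraph) (hΓ : Γ.Wf) :
    Γ.ATB = 0 ↔ ∃ g : TTriple, g.Valid ∧ Γ = gammaA g := by
  constructor
  · exact aux_forward Γ hΓ
  · rintro ⟨g, hg, rfl⟩
    exact aux_backward g hg
end

section
/- For every element g = (R,S;k) of Thompson's group T, the edge-signed graph Γ_A(g) embedded in the annulus A is ATB-friendly and satisfies: |e^up_−| = 0, |e^down_+| = 0, Σ_{v ≠ v_L} |1 − |e^in_v ∩ e^down|| = 0, and Σ_{v ≠ v_1} |1 − |e^<_v ∩ e^up|| = 0; in particular ATB(Γ_A(g)) = 0. -/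
theorem leaves_pos' (t : PlanarBinTree) : 0 < t.leaves := by
  induction t with
  | leaf => simp [PlanarBinTree.leaves]
  | node l r hl hr => simp only [PlanarBinTree.leaves]; omega

theorem tge_bounds (t : PlanarBinTree) : ∀ o, ∀ e ∈ treeGraphEdges t o,
    o ≤ e.1 ∧ e.1 < e.2 ∧ e.2 < o + t.leaves := by
  induction t with
  | leaf => intro o e he; simp [treeGraphEdges] at he
  | node l r hl hr =>
    intro o e he
    have h1 := leaves_pos' l
    have h2 := leaves_pos' r
    simp only [treeGraphEdges, Multiset.mem_cons, Multiset.mem_add] at he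
    simp only [PlanarBinTree.leaves]
    rcases he with rfl | he | he
    · simp only; omega
    · have := hl _ _ he; omega
    · have := hr _ _ he; omega

theorem tge_noncross (t : PlanarBinTree) : ∀ o, ∀ e ∈ treeGraphEdges t o,
    ∀ f ∈ treeGraphEdges t o, ¬(e.1 < f.1 ∧ f.1 < e.2 ∧ e.2 < f.2) := by
  induction t with
  | leaf => intro o e he; simp [treeGraphEdges] at he
  | node l r hl hr =>
    intro o e he f hf
    simp only [treeGraphEdges, Multiset.mem_cons, Multiset.mem_add] at he hf
    rcases he with rfl | he | he <;> rcases hf with rfl | hf | hf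
    · simp only; omega
    · have := tge_bounds _ _ _ hf; simp only; omega
    · have := tge_bounds _ _ _ hf; simp only; omega
    · have := tge_bounds _ _ _ he; simp only; omega
    · exact hl _ _ he _ hf
    · have := tge_bounds _ _ _ he; have := tge_bounds _ _ _ hf; omega
    · have := tge_bounds _ _ _ he; simp only; omega
    · have := tge_bounds _ _ _ he; have := tge_bounds _ _ _ hf; omega
    · exact hr _ _ he _ hf

theorem tge_count (t : PlanarBinTree) (v : ℕ) : ∀ o,
    (treeGraphEdges t o).countP (fun e => e.2 = v) =
      if o < v ∧ v < o + t.leaves then 1 else 0 := by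
  induction t with
  | leaf =>
    intro o
    rw [if_neg (by simp only [PlanarBinTree.leaves]; omega)]
    simp [treeGraphEdges]
  | node l r hl hr =>
    intro o
    have h1 := leaves_pos' l
    have h2 := leaves_pos' r
    simp only [treeGraphEdges, Multiset.countP_cons, Multiset.countP_add, hl, hr]
    have h3 : (l.node r).leaves = l.leaves + r.leaves := rfl
    by_cases hc : o < v ∧ v < o + (l.node r).leaves
    · rw [if_pos hc]; split_ifs <;> omega
    · rw [if_neg hc]; split_ifs <;> omega

theorem pos_spec (n nl i : ℕ) (hnl : nl < n) (hi : i < n) :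
    (i + nl < n ∧ posOfLabel n nl (i + 1) = i + nl) ∨
    (n ≤ i + nl ∧ posOfLabel n nl (i + 1) + n = i + nl) := by
  unfold posOfLabel
  split_ifs <;> omega

theorem label_spec (Γ : SignedAnnularGraph) (p : ℕ) (hnl : Γ.numLeft < Γ.N) :
    (Γ.numLeft ≤ p ∧ Γ.label p + Γ.numLeft = p + 1) ∨
    (p < Γ.numLeft ∧ Γ.label p + Γ.numLeft = p + Γ.N + 1) := by
  unfold SignedAnnularGraph.label
  split_ifs <;> omega

/-- For every element `g = (R,S;k)` of Thompson's group `T`, the edge-signed graph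
`Γ_𝔸(g)` embedded in the annulus is ATB-friendly and satisfies `|e^up_-| = 0`,
`|e^down_+| = 0`, `Σ_{v ≠ v_L} |1 - |e^in_v ∩ e^down|| = 0` and
`Σ_{v ≠ v₁} |1 - |e^<_v ∩ e^up|| = 0`; in particular `ATB(Γ_𝔸(g)) = 0`. -/
theorem gammaA_ATB_eq_zero (g : TTriple) (hg : g.Valid) :
    (gammaA g).Wf ∧ (gammaA g).upNeg = 0 ∧ (gammaA g).downPos = 0 ∧
      (gammaA g).sumDown = 0 ∧ (gammaA g).sumUp = 0 ∧ (gammaA g).ATB = 0 := by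
  obtain ⟨hRS, hk1, hk2⟩ := hg
  have hn := leaves_pos' g.R
  have hN : (gammaA g).N = g.R.leaves := rfl
  have hnl : (gammaA g).numLeft < g.R.leaves := Nat.mod_lt _ hn
  generalize hΓ : gammaA g = Γ at *
  have hE : Γ.edges = (treeGraphEdges g.S 0).map (fun e => (e.1, e.2, false, false)) +
      (treeGraphEdges g.R 0).map (fun e =>
        (min (posOfLabel g.R.leaves Γ.numLeft (e.1 + 1))
          (posOfLabel g.R.leaves Γ.numLeft (e.2 + 1)),
         max (posOfLabel g.R.leaves Γ.numLeft (e.1 + 1))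
          (posOfLabel g.R.leaves Γ.numLeft (e.2 + 1)), true, true)) := by
    subst hΓ; rfl
  have hwf : Γ.Wf := by
    refine ⟨by omega, by omega, ?_, ?_⟩
    · intro e he
      rw [hE, Multiset.mem_add, Multiset.mem_map, Multiset.mem_map] at he
      rcases he with ⟨a, ha, rfl⟩ | ⟨a, ha, rfl⟩
      · have := tge_bounds _ _ _ ha
        simp only; omega
      · have := tge_bounds _ _ _ ha
        have h1 := pos_spec g.R.leaves Γ.numLeft a.1 hnl (by omega)
        have h2 := pos_spec g.R.leaves Γ.numLeft a.2 hnl (by omega)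
        simp only; omega
    · intro e he f hf hef
      rw [hE, Multiset.mem_add, Multiset.mem_map, Multiset.mem_map] at he hf
      rcases he with ⟨a, ha, rfl⟩ | ⟨a, ha, rfl⟩ <;>
        rcases hf with ⟨b, hb, rfl⟩ | ⟨b, hb, rfl⟩
      · exact tge_noncross _ _ _ ha _ hb
      · simp at hef
      · simp at hef
      · have := tge_bounds _ _ _ ha
        have := tge_bounds _ _ _ hb
        have := tge_noncross _ _ _ ha _ hb
        have := tge_noncross _ _ _ hb _ ha
        have h1 := pos_spec g.R.leaves Γ.numLeft a.1 hnl (by omega)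
        have h2 := pos_spec g.R.leaves Γ.numLeft a.2 hnl (by omega)
        have h3 := pos_spec g.R.leaves Γ.numLeft b.1 hnl (by omega)
        have h4 := pos_spec g.R.leaves Γ.numLeft b.2 hnl (by omega)
        simp only
        generalize posOfLabel g.R.leaves Γ.numLeft (a.1 + 1) = x1 at *
        generalize posOfLabel g.R.leaves Γ.numLeft (a.2 + 1) = x2 at *
        generalize posOfLabel g.R.leaves Γ.numLeft (b.1 + 1) = x3 at *
        generalize posOfLabel g.R.leaves Γ.numLeft (b.2 + 1) = x4 at *
        rcases h1 with h1 | h1 <;> rcases h2 with h2 | h2 <;> rcases h3 with h3 | h3 <;>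
          rcases h4 with h4 | h4 <;> omega
  have hup : Γ.upNeg = 0 := by
    simp [SignedAnnularGraph.upNeg, hE, Multiset.filter_map]
  have hdown : Γ.downPos = 0 := by
    simp [SignedAnnularGraph.downPos, hE, Multiset.filter_map]
  have hsd : Γ.sumDown = 0 := by
    unfold SignedAnnularGraph.sumDown
    refine Finset.sum_eq_zero fun p hp => ?_
    rw [Finset.mem_range] at hp
    split_ifs with h0
    · rfl
    have : Γ.inDown p = 1 := by
      have h := tge_count g.S p 0
      rw [if_pos (by omega)] at h
      rw [← h, SignedAnnularGraph.inDown, ← Multiset.countP_eq_card_filter, hE,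
        Multiset.countP_add, Multiset.countP_map, Multiset.countP_map,
        ← Multiset.countP_eq_card_filter, ← Multiset.countP_eq_card_filter]
      simp
    simp [this]
  have hsu : Γ.sumUp = 0 := by
    unfold SignedAnnularGraph.sumUp
    refine Finset.sum_eq_zero fun p hp => ?_
    rw [Finset.mem_range] at hp
    split_ifs with h0
    · rfl
    have : Γ.ltUp p = 1 := by
      have hl := label_spec Γ p (by omega)
      have h := tge_count g.R (Γ.label p - 1) 0
      rw [if_pos (by omega)] at h
      rw [← h, SignedAnnularGraph.ltUp, ← Multiset.countP_eq_card_filter, hE,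
        Multiset.countP_add, Multiset.countP_map, Multiset.countP_map,
        ← Multiset.countP_eq_card_filter, ← Multiset.countP_eq_card_filter]
      rw [Multiset.countP_eq_zero.2 (by simp), zero_add]
      refine Multiset.countP_congr rfl fun a ha => ?_
      have := tge_bounds _ _ _ ha
      have h1 := pos_spec g.R.leaves Γ.numLeft a.1 hnl (by omega)
      have h2 := pos_spec g.R.leaves Γ.numLeft a.2 hnl (by omega)
      simp only [true_and]
      generalize posOfLabel g.R.leaves Γ.numLeft (a.1 + 1) = x1 at *
      generalize posOfLabel g.R.leaves Γ.numLeft (a.2 + 1) = x2 at *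
      have l1 := label_spec Γ x1 (by omega)
      have l2 := label_spec Γ x2 (by omega)
      have e1 : Γ.label x1 = a.1 + 1 := by omega
      have e2 : Γ.label x2 = a.2 + 1 := by omega
      clear l1 l2
      rcases le_total x1 x2 with hx | hx
      · rw [min_eq_left hx, max_eq_right hx, e1, e2]; first | omega | (rw [eq_iff_iff]; omega)
      · rw [min_eq_right hx, max_eq_left hx, e1, e2]; first | omega | (rw [eq_iff_iff]; omega)
    simp [this]
  exact ⟨hwf, hup, hdown, hsd, hsu, by simp [SignedAnnularGraph.ATB, hup, hdown, hsd, hsu]⟩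
end
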